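/- arXiv:1408.5591 — 8 statements merged into one kernel-verified Lean document; each statement's English description precedes it below -/
import Mathlib

section
/- Let u : ℝ → ℝ be infinitely differentiable and let x₀ ∈ ℝ. Then, as h → 0⁺, one has (1/h²)·(δ_h²(1 − (1/12)δ_h²)u)(x₀) − u''(x₀) + (1/90)·(δ_h⁴(u''))(x₀) = (13/15120)·u⁽⁸⁾(x₀)·h⁶ + O(h⁸); in particular this quantity is O(h⁶), which expresses the sixth-order accuracy of the compact approximation ∂²u/∂x² = h⁻²(1 − (1/90)δ_h⁴)⁻¹ δ_h²(1 − (1/12)δ_h²)u + O(h⁶) of Lemma 1, equation (4). -/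
/-- Centered second difference operator: `(δ_h² u)(x) = u(x+h) − 2u(x) + u(x−h)`. -/
noncomputable def d2 (h : ℝ) (u : ℝ → ℝ) : ℝ → ℝ :=
  fun x => u (x + h) - 2 * u x + u (x - h)

open Asymptotics Filter Topology in
/-- Taylor's formula with `O(h ^ n)` remainder, at a point moving along the line `x₀ + c * h`. -/
theorem ContDiff.isBigO_sub_taylor_mul {f : ℝ → ℝ} {n : ℕ} (hf : ContDiff ℝ n f) (x₀ c : ℝ) :
    (fun h : ℝ => f (x₀ + c * h) -
        ∑ k ∈ Finset.range n, (k.factorial : ℝ)⁻¹ * iteratedDeriv k f x₀ * (c * h) ^ k)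
      =O[𝓝 0] (fun h : ℝ => h ^ n) := by
  have hlim : Tendsto (fun h : ℝ => x₀ + c * h) (𝓝 0) (𝓝 x₀) :=
    Continuous.tendsto' (by fun_prop) _ _ (by simp)
  have hpow : (fun h : ℝ => (c * h) ^ n) =O[𝓝 0] (fun h : ℝ => h ^ n) := by
    simpa only [mul_pow] using isBigO_const_mul_self (c ^ n) (fun h : ℝ => h ^ n) (𝓝 0)
  have hrem := ((taylor_isLittleO_univ hf (x₀ := x₀)).comp_tendsto hlim).isBigO
  simp only [Function.comp_def, add_sub_cancel_left] at hrem
  refine ((hrem.trans hpow).add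
    (hpow.const_mul_left ((n.factorial : ℝ)⁻¹ * iteratedDeriv n f x₀))).congr_left fun h => ?_
  simp only [taylor_within_apply, iteratedDerivWithin_univ, add_sub_cancel_left, smul_eq_mul,
    Finset.sum_range_succ]
  rw [Finset.sum_congr rfl fun k _ => mul_right_comm _ ((c * h) ^ k) (iteratedDeriv k f x₀)]
  ring

/-- Sixth-order accuracy of the compact approximation of Lemma 1, eq. (4). -/
theorem stmt0 (u : ℝ → ℝ) (hu : ContDiff ℝ (⊤ : ℕ∞) u) (x₀ : ℝ) :
    (fun h : ℝ =>
        (1 / h ^ 2) * d2 h (fun x => u x - (1 / 12) * d2 h u x) x₀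
          - iteratedDeriv 2 u x₀
          + (1 / 90) * d2 h (d2 h (iteratedDeriv 2 u)) x₀
          - (13 / 15120) * iteratedDeriv 8 u x₀ * h ^ 6)
      =O[nhdsWithin 0 (Set.Ioi 0)] (fun h : ℝ => h ^ 8)
    ∧
    (fun h : ℝ =>
        (1 / h ^ 2) * d2 h (fun x => u x - (1 / 12) * d2 h u x) x₀
          - iteratedDeriv 2 u x₀
          + (1 / 90) * d2 h (d2 h (iteratedDeriv 2 u)) x₀)
      =O[nhdsWithin 0 (Set.Ioi 0)] (fun h : ℝ => h ^ 6) := by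
  have hd2 : ContDiff ℝ (⊤ : ℕ∞) (iteratedDeriv 2 u) := by
    rw [iteratedDeriv_eq_iterate]
    exact hu.iterate_deriv 2
  have hiter (k : ℕ) : iteratedDeriv k (iteratedDeriv 2 u) x₀ = iteratedDeriv (k + 2) u x₀ := by
    simp only [iteratedDeriv_eq_iterate, Function.iterate_add_apply]
  have hR (c : ℝ) := ((contDiff_infty.mp hu 10).isBigO_sub_taylor_mul (n := 10) x₀ c).mono
    (nhdsWithin_le_nhds (s := Set.Ioi 0))
  have hS (c : ℝ) := ((contDiff_infty.mp hd2 8).isBigO_sub_taylor_mul (n := 8) x₀ c).mono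
    (nhdsWithin_le_nhds (s := Set.Ioi 0))
  have hU := (((((hR 1).add (hR (-1))).const_mul_left (4 / 3)).sub
    ((hR 0).const_mul_left (5 / 2))).sub (((hR 2).add (hR (-2))).const_mul_left (1 / 12)))
  have hV := (((((hS 2).add (hS (-2))).sub (((hS 1).add (hS (-1))).const_mul_left 4)).add
    ((hS 0).const_mul_left 6)).const_mul_left (1 / 90))
  have hinv : (fun h : ℝ => 1 / h ^ 2 * h ^ 10) =ᶠ[nhdsWithin 0 (Set.Ioi 0)]
      (fun h : ℝ => h ^ 8) := by
    filter_upwards [self_mem_nhdsWithin] with h hh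
    have : h ≠ 0 := (Set.mem_Ioi.mp hh).ne'
    field_simp
  have hsharp : (fun h : ℝ =>
        (1 / h ^ 2) * d2 h (fun x => u x - (1 / 12) * d2 h u x) x₀
          - iteratedDeriv 2 u x₀
          + (1 / 90) * d2 h (d2 h (iteratedDeriv 2 u)) x₀
          - (13 / 15120) * iteratedDeriv 8 u x₀ * h ^ 6)
      =O[nhdsWithin 0 (Set.Ioi 0)] (fun h : ℝ => h ^ 8) := by
    refine ((((Asymptotics.isBigO_refl (fun h : ℝ => 1 / h ^ 2) _).mul hU).trans_eventuallyEq
      hinv).add hV).congr' ?_ .rfl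
    filter_upwards [self_mem_nhdsWithin] with h hh
    have hne : h ≠ 0 := (Set.mem_Ioi.mp hh).ne'
    have e1 : x₀ + h + h = x₀ + 2 * h := by ring
    have e2 : x₀ - h - h = x₀ + -2 * h := by ring
    have e3 : x₀ - h = x₀ + -1 * h := by ring
    simp only [d2, add_sub_cancel_right, sub_add_cancel, e1, e2]
    simp only [e3, Finset.sum_range_succ, Finset.sum_range_zero, hiter, Nat.factorial, one_mul,
      zero_mul, add_zero]
    push_cast
    field_simp
    ring
  refine ⟨hsharp, ?_⟩
  have h86 : (fun h : ℝ => h ^ 8) =O[nhdsWithin 0 (Set.Ioi 0)] (fun h : ℝ => h ^ 6) :=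
    (Asymptotics.isLittleO_pow_pow (by norm_num)).isBigO.mono nhdsWithin_le_nhds
  refine ((hsharp.trans h86).add ((Asymptotics.isBigO_refl (fun h : ℝ => h ^ 6) _).const_mul_left
    (13 / 15120 * iteratedDeriv 8 u x₀))).congr_left fun h => ?_
  ring
end

section
/- For every real γ with 0 < γ < 1: the series ∑_{ℓ=0}^{∞} ϖ_ℓ^{(1−γ)} converges and its sum equals 0; moreover, for every integer k ≥ 1, −∑_{ℓ=1}^{k} ϖ_ℓ^{(1−γ)} < 1 (equivalently, the partial sums satisfy ∑_{ℓ=0}^{k} ϖ_ℓ^{(1−γ)} > 0). -/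
/-- Generalized binomial coefficient `C(μ,ℓ) = μ(μ−1)⋯(μ−ℓ+1)/ℓ!`. -/
noncomputable def genBinom (μ : ℝ) (ℓ : ℕ) : ℝ :=
  (∏ i ∈ Finset.range ℓ, (μ - i)) / (Nat.factorial ℓ : ℝ)

/-- Grünwald–Letnikov coefficient `ϖ_ℓ^{(μ)} = (−1)^ℓ · C(μ,ℓ)`. -/
noncomputable def varpi (μ : ℝ) (ℓ : ℕ) : ℝ :=
  (-1 : ℝ) ^ ℓ * genBinom μ ℓ

/-- The coefficients `g_ℓ^{(1−γ)}`. -/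
noncomputable def gcoef (γ : ℝ) : ℕ → ℝ
  | 0 => ((2 - γ) / 2) * varpi (1 - γ) 0
  | (ℓ + 1) => ((2 - γ) / 2) * varpi (1 - γ) (ℓ + 1) + (γ / 2) * varpi (1 - γ) ℓ

open Filter

theorem varpi_zero (μ : ℝ) : varpi μ 0 = 1 := by
  simp [varpi, genBinom]

theorem varpi_succ (μ : ℝ) (n : ℕ) :
    varpi μ (n + 1) = varpi μ n * ((n - μ) / (n + 1)) := by
  have h : (Nat.factorial n : ℝ) ≠ 0 := by positivity
  have h' : (n : ℝ) + 1 ≠ 0 := by positivity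
  simp only [varpi, genBinom, Finset.prod_range_succ, Nat.factorial_succ, pow_succ]
  push_cast
  field_simp
  ring

theorem varpi_succ_eq_prod (μ : ℝ) (n : ℕ) :
    varpi μ (n + 1) = -μ / (n + 1) * ∏ i ∈ Finset.range n, (1 - μ / ((i : ℝ) + 1)) := by
  induction n with
  | zero => simp [varpi_succ, varpi_zero]
  | succ n ih =>
    have h : (n : ℝ) + 1 ≠ 0 := by positivity
    have h' : (n : ℝ) + 1 + 1 ≠ 0 := by positivity
    rw [varpi_succ, ih, Finset.prod_range_succ]
    push_cast
    field_simp

theorem sum_varpi_eq_prod (μ : ℝ) (n : ℕ) :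
    ∑ ℓ ∈ Finset.range (n + 1), varpi μ ℓ =
      ∏ i ∈ Finset.range n, (1 - μ / ((i : ℝ) + 1)) := by
  induction n with
  | zero => simp [varpi_zero]
  | succ n ih =>
    rw [Finset.sum_range_succ, ih, varpi_succ_eq_prod, Finset.prod_range_succ]
    ring

theorem one_sub_div_pos {μ : ℝ} (h1 : μ < 1) (i : ℕ) : 0 < 1 - μ / ((i : ℝ) + 1) := by
  have h : (0 : ℝ) < i + 1 := by positivity
  rw [sub_pos, div_lt_one h]
  linarith [(Nat.cast_nonneg i : (0 : ℝ) ≤ i)]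

theorem sum_varpi_pos {μ : ℝ} (h1 : μ < 1) (n : ℕ) :
    0 < ∑ ℓ ∈ Finset.range (n + 1), varpi μ ℓ := by
  rw [sum_varpi_eq_prod]
  exact Finset.prod_pos fun i _ => one_sub_div_pos h1 i

theorem tendsto_sum_varpi {μ : ℝ} (h0 : 0 < μ) (h1 : μ < 1) :
    Tendsto (fun n : ℕ => ∑ ℓ ∈ Finset.range n, varpi μ ℓ) atTop (nhds 0) := by
  rw [← tendsto_add_atTop_iff_nat 1]
  refine squeeze_zero (g := fun n : ℕ =>
    Real.exp (-(μ * ∑ i ∈ Finset.range n, 1 / ((i : ℝ) + 1))))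
    (fun n => (sum_varpi_pos h1 n).le) (fun n => ?_) ?_
  · rw [sum_varpi_eq_prod, Finset.mul_sum, ← Finset.sum_neg_distrib, Real.exp_sum]
    refine Finset.prod_le_prod (fun i _ => (one_sub_div_pos h1 i).le) fun i _ => ?_
    rw [mul_one_div]
    exact Real.one_sub_le_exp_neg _
  · exact Real.tendsto_exp_neg_atTop_nhds_zero.comp
      (Real.tendsto_sum_range_one_div_nat_succ_atTop.const_mul_atTop h0)

/-- Lemma 4(ii): the series of Grünwald–Letnikov coefficients sums to 0 and
the partial sums satisfy . -/
theorem stmt5 (γ : ℝ) (hγ0 : 0 < γ) (hγ1 : γ < 1) :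
    Tendsto (fun n : ℕ => ∑ ℓ ∈ Finset.range n, varpi (1 - γ) ℓ) atTop (nhds 0) ∧
      ∀ k : ℕ, 1 ≤ k → -∑ ℓ ∈ Finset.Icc 1 k, varpi (1 - γ) ℓ < 1 := by
  refine ⟨tendsto_sum_varpi (by linarith) (by linarith), fun k _ => ?_⟩
  have h := sum_varpi_pos (μ := 1 - γ) (by linarith) k
  rw [Finset.range_eq_Ico, Finset.sum_eq_sum_Ico_succ_bot k.succ_pos, varpi_zero] at h
  have hIcc : Finset.Icc 1 k = Finset.Ico (0 + 1) (k + 1) := by ext; simp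
  rw [hIcc]
  linarith
end

section
/- For every real γ with 0 < γ < 1 and every integer ℓ ≥ 1, one has g_ℓ^{(1−γ)} = [(2ℓ − (2−γ)²)/(2(ℓ + γ − 2))]·ϖ_ℓ^{(1−γ)} (note that ℓ + γ − 2 ≠ 0 for all integers ℓ when 0 < γ < 1). -/
theorem varpi_succ_mul (μ : ℝ) (n : ℕ) :
    ((n : ℝ) + 1) * varpi μ (n + 1) = ((n : ℝ) - μ) * varpi μ n := by
  have hf : (n.factorial : ℝ) ≠ 0 := by positivity
  have hn : (n : ℝ) + 1 ≠ 0 := by positivity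
  simp only [varpi, genBinom, Finset.prod_range_succ, Nat.factorial_succ, Nat.cast_mul,
    Nat.cast_add, Nat.cast_one]
  field_simp
  ring

/-- The closed form of `g_ℓ^{(1−γ)}` for `ℓ ≥ 1`. -/
theorem stmt6 (γ : ℝ) (hγ0 : 0 < γ) (hγ1 : γ < 1) :
    ∀ ℓ : ℕ, 1 ≤ ℓ →
      gcoef γ ℓ =
        ((2 * (ℓ : ℝ) - (2 - γ) ^ 2) / (2 * ((ℓ : ℝ) + γ - 2))) * varpi (1 - γ) ℓ := by
  intro ℓ hℓ
  obtain ⟨n, rfl⟩ := Nat.exists_eq_add_of_le' hℓ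
  have hne : (n : ℝ) + 1 + γ - 2 ≠ 0 := by
    rcases n with _ | n
    · exact ne_of_lt (by push_cast; linarith)
    · have : (0 : ℝ) ≤ n := n.cast_nonneg
      push_cast
      exact ne_of_gt (by linarith)
  have hrec := varpi_succ_mul (1 - γ) n
  simp only [gcoef]
  push_cast
  rw [div_mul_eq_mul_div (2 * _ - _), eq_div_iff (mul_ne_zero two_ne_zero hne)]
  linear_combination (-γ) * hrec
end

section
/- For every θ ∈ ℝ, the eigenvalue expression of the sixth-order compact scheme, λ(θ) = [1 − (8/45)·sin⁴θ] + 4·G_0·sin²θ·[1 + (1/3)·sin²θ], is strictly positive. (These are the eigenvalues λ_j = λ(πj/(M−1)), j = 1, …, M−1, of the coefficient matrix of scheme (13), whose positivity yields its unique solvability in Theorem 1.) -/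
/-- Positivity of the eigenvalue expression of the sixth-order compact scheme (13). -/
theorem stmt9 (α β μa μb : ℝ) (hα0 : 0 < α) (hα1 : α < 1) (hβ0 : 0 < β) (hβ1 : β < 1)
    (hμa : 0 < μa) (hμb : 0 < μb) :
    ∀ θ : ℝ,
      0 < (1 - (8 / 45) * Real.sin θ ^ 4) +
            4 * (μa * ((2 - α) / 2) + μb * ((2 - β) / 2)) * Real.sin θ ^ 2 *
              (1 + (1 / 3) * Real.sin θ ^ 2) := by
  intro θ
  have hG : 0 ≤ μa * ((2 - α) / 2) + μb * ((2 - β) / 2) :=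
    add_nonneg (mul_nonneg hμa.le (by linarith)) (mul_nonneg hμb.le (by linarith))
  have hsin : Real.sin θ ^ 4 ≤ 1 := by
    have h := pow_le_one₀ (n := 2) (sq_nonneg (Real.sin θ)) (Real.sin_sq_le_one θ)
    rwa [← pow_mul] at h
  exact add_pos_of_pos_of_nonneg (by linarith) (by positivity)
end

section
/- For every θ ∈ ℝ, the eigenvalue expression of the eighth-order compact scheme, λ̃(θ) = [1 − (4/35)·sin⁶θ] + 4·G_0·sin²θ·[1 + (1/3)·sin²θ + (8/45)·sin⁴θ], is strictly positive. (These are the eigenvalues λ̃_j = λ̃(πj/(M−1)), j = 1, …, M−1, of the coefficient matrix of scheme (14), whose positivity yields its unique solvability in Theorem 1.) -/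
/-- Positivity of the eigenvalue expression of the eighth-order compact scheme (14). -/
theorem stmt10 (α β μa μb : ℝ) (hα0 : 0 < α) (hα1 : α < 1) (hβ0 : 0 < β) (hβ1 : β < 1)
    (hμa : 0 < μa) (hμb : 0 < μb) :
    ∀ θ : ℝ,
      0 < (1 - (4 / 35) * Real.sin θ ^ 6) +
            4 * (μa * ((2 - α) / 2) + μb * ((2 - β) / 2)) * Real.sin θ ^ 2 *
              (1 + (1 / 3) * Real.sin θ ^ 2 + (8 / 45) * Real.sin θ ^ 4) := by
  intro θ
  have hα : 0 < (2 - α) / 2 := by linarith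
  have hβ : 0 < (2 - β) / 2 := by linarith
  have hsin : Real.sin θ ^ 6 ≤ 1 := by
    have h : (Real.sin θ ^ 2) ^ 3 ≤ 1 := pow_le_one₀ (sq_nonneg _) (Real.sin_sq_le_one θ)
    rwa [← pow_mul] at h
  have hcompact : 0 < 1 - (4 / 35) * Real.sin θ ^ 6 := by linarith
  positivity
end

section
/- For every s ∈ [0,1], one has |P(s)| ≤ Q(s); in particular Q(s) > 0 and |P(s)/Q(s)| ≤ 1. -/
/-- `G_ℓ = μ_α·g_ℓ^{(1−α)} + μ_β·g_ℓ^{(1−β)}`. -/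
noncomputable def Gc (μa μb α β : ℝ) (ℓ : ℕ) : ℝ :=
  μa * gcoef α ℓ + μb * gcoef β ℓ

/-- `Q(s)` of the sixth-order compact scheme. -/
noncomputable def Qfun (μa μb α β s : ℝ) : ℝ :=
  (1 - (8 / 45) * s ^ 2) + 4 * Gc μa μb α β 0 * s * (1 + s / 3)

/-- `P(s)` of the sixth-order compact scheme. -/
noncomputable def Pfun (μa μb α β s : ℝ) : ℝ :=
  (1 - (8 / 45) * s ^ 2) - 4 * Gc μa μb α β 1 * s * (1 + s / 3)

/-- `Q̃(s)` of the eighth-order compact scheme. -/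
noncomputable def Qtfun (μa μb α β s : ℝ) : ℝ :=
  (1 - (4 / 35) * s ^ 3) + 4 * Gc μa μb α β 0 * s * (1 + s / 3 + (8 / 45) * s ^ 2)

/-- `P̃(s)` of the eighth-order compact scheme. -/
noncomputable def Ptfun (μa μb α β s : ℝ) : ℝ :=
  (1 - (4 / 35) * s ^ 3) - 4 * Gc μa μb α β 1 * s * (1 + s / 3 + (8 / 45) * s ^ 2)


theorem gcoef_zero (γ : ℝ) : gcoef γ 0 = (2 - γ) / 2 := by
  simp [gcoef, varpi, genBinom]

theorem gcoef_one (γ : ℝ) : gcoef γ 1 = (-γ ^ 2 + 4 * γ - 2) / 2 := by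
  simp [gcoef, varpi, genBinom]
  ring

theorem gcoef_zero_pos {γ : ℝ} (h1 : γ < 1) : 0 < gcoef γ 0 := by
  rw [gcoef_zero]
  linarith

theorem abs_gcoef_one_le {γ : ℝ} (h0 : 0 < γ) (h1 : γ < 1) : |gcoef γ 1| ≤ gcoef γ 0 := by
  rw [gcoef_zero, gcoef_one, abs_le]
  constructor <;> nlinarith

/-- Lemma 5 (stability):  `|P(s)| ≤ Q(s)`, `Q(s) > 0` and `|P(s)/Q(s)| ≤ 1`. -/
theorem stmt11 (α β μa μb : ℝ) (hα0 : 0 < α) (hα1 : α < 1) (hβ0 : 0 < β) (hβ1 : β < 1)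
    (hμa : 0 < μa) (hμb : 0 < μb) :
    ∀ s ∈ Set.Icc (0 : ℝ) 1,
      |Pfun μa μb α β s| ≤ Qfun μa μb α β s ∧
        0 < Qfun μa μb α β s ∧
        |Pfun μa μb α β s / Qfun μa μb α β s| ≤ 1 := by
  rintro s ⟨hs0, hs1⟩
  have hG0 : 0 < Gc μa μb α β 0 :=
    add_pos (mul_pos hμa (gcoef_zero_pos hα1)) (mul_pos hμb (gcoef_zero_pos hβ1))
  have hG1 : |Gc μa μb α β 1| ≤ Gc μa μb α β 0 := by
    refine (abs_add_le _ _).trans ?_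
    rw [abs_mul, abs_mul, abs_of_pos hμa, abs_of_pos hμb]
    exact add_le_add (mul_le_mul_of_nonneg_left (abs_gcoef_one_le hα0 hα1) hμa.le)
      (mul_le_mul_of_nonneg_left (abs_gcoef_one_le hβ0 hβ1) hμb.le)
  have hA : 0 < 1 - (8 / 45) * s ^ 2 := by nlinarith
  have hB : 0 ≤ s * (1 + s / 3) := by positivity
  have hQ : 0 < Qfun μa μb α β s := by
    unfold Qfun
    have := mul_nonneg hG0.le hB
    linarith
  have hPQ : |Pfun μa μb α β s| ≤ Qfun μa μb α β s := by
    obtain ⟨h1, h2⟩ := abs_le.mp hG1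
    have h3 := mul_le_mul_of_nonneg_right h1 hB
    have h4 := mul_le_mul_of_nonneg_right h2 hB
    unfold Pfun Qfun
    rw [abs_le]
    constructor <;> linarith
  refine ⟨hPQ, hQ, ?_⟩
  rw [abs_div, abs_of_pos hQ]
  exact div_le_one_of_le₀ hPQ hQ.le
end

section
/- If μ_α·(−α² + 4α − 2) + μ_β·(−β² + 4β − 2) ≤ 279/952, then P̃(s) ≥ 0 for every s ∈ [0,1]. -/
/-- Lemma 9: the stability condition implies `P̃(s) ≥ 0`. -/
theorem stmt15 (α β μa μb : ℝ) (hα0 : 0 < α) (hα1 : α < 1) (hβ0 : 0 < β) (hβ1 : β < 1)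
    (hμa : 0 < μa) (hμb : 0 < μb)
    (hcond : μa * (-α ^ 2 + 4 * α - 2) + μb * (-β ^ 2 + 4 * β - 2) ≤ 279 / 952) :
    ∀ s ∈ Set.Icc (0 : ℝ) 1, 0 ≤ Ptfun μa μb α β s := by
  rintro s ⟨hs0, hs1⟩
  have hG : 2 * Gc μa μb α β 1 ≤ 279 / 952 := by
    rw [Gc, gcoef_one, gcoef_one]
    linarith
  have hK : 0 ≤ s * (1 + s / 3 + 8 / 45 * s ^ 2) := by positivity
  have hmul := mul_le_mul_of_nonneg_right hG hK
  have hs2 : s ^ 2 ≤ 1 := pow_le_one₀ hs0 hs1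
  have hs3 : s ^ 3 ≤ 1 := pow_le_one₀ hs0 hs1
  rw [Ptfun]
  linarith
end

section
/- If 0 < α ≤ 2 − √2 and 0 < β ≤ 2 − √2, then −α² + 4α − 2 ≤ 0 and −β² + 4β − 2 ≤ 0; consequently, for all positive reals μ_α, μ_β one has μ_α·(−α² + 4α − 2) + μ_β·(−β² + 4β − 2) ≤ 0, and hence P(s) ≥ 0 and P̃(s) ≥ 0 for every s ∈ [0,1] (i.e., the stability conditions of both compact schemes hold for all step sizes, so the schemes are unconditionally stable). -/
theorem Gc_one (μa μb α β : ℝ) :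
    Gc μa μb α β 1 = (μa * (-α ^ 2 + 4 * α - 2) + μb * (-β ^ 2 + 4 * β - 2)) / 2 := by
  rw [Gc, gcoef_one, gcoef_one]
  ring

theorem quadratic_nonpos_of_le_two_sub_sqrt_two {γ : ℝ} (h : γ ≤ 2 - Real.sqrt 2) :
    -γ ^ 2 + 4 * γ - 2 ≤ 0 := by
  have hsq : Real.sqrt 2 ^ 2 = 2 := Real.sq_sqrt (by norm_num)
  have hle : Real.sqrt 2 ^ 2 ≤ (2 - γ) ^ 2 :=
    pow_le_pow_left₀ (Real.sqrt_nonneg 2) (by linarith) 2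
  linarith

theorem Pfun_nonneg {μa μb α β s : ℝ} (hG : Gc μa μb α β 1 ≤ 0) (hs : s ∈ Set.Icc (0 : ℝ) 1) :
    0 ≤ Pfun μa μb α β s := by
  obtain ⟨hs0, hs1⟩ := hs
  have hpow : s ^ 2 ≤ 1 := pow_le_one₀ hs0 hs1
  have hprod : 0 ≤ -Gc μa μb α β 1 * (s * (1 + s / 3)) :=
    mul_nonneg (neg_nonneg.mpr hG) (by positivity)
  rw [Pfun]
  linarith

theorem Ptfun_nonneg {μa μb α β s : ℝ} (hG : Gc μa μb α β 1 ≤ 0) (hs : s ∈ Set.Icc (0 : ℝ) 1) :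
    0 ≤ Ptfun μa μb α β s := by
  obtain ⟨hs0, hs1⟩ := hs
  have hpow : s ^ 3 ≤ 1 := pow_le_one₀ hs0 hs1
  have hprod : 0 ≤ -Gc μa μb α β 1 * (s * (1 + s / 3 + (8 / 45) * s ^ 2)) :=
    mul_nonneg (neg_nonneg.mpr hG) (by positivity)
  rw [Ptfun]
  linarith

/-- Remark 2: unconditional stability when `α, β ∈ (0, 2−√2]`. -/
theorem stmt19 (α β μa μb : ℝ) (hα0 : 0 < α) (hα2 : α ≤ 2 - Real.sqrt 2)
    (hβ0 : 0 < β) (hβ2 : β ≤ 2 - Real.sqrt 2)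
    (hμa : 0 < μa) (hμb : 0 < μb) :
    -α ^ 2 + 4 * α - 2 ≤ 0 ∧
      -β ^ 2 + 4 * β - 2 ≤ 0 ∧
      μa * (-α ^ 2 + 4 * α - 2) + μb * (-β ^ 2 + 4 * β - 2) ≤ 0 ∧
      (∀ s ∈ Set.Icc (0 : ℝ) 1, 0 ≤ Pfun μa μb α β s) ∧
      (∀ s ∈ Set.Icc (0 : ℝ) 1, 0 ≤ Ptfun μa μb α β s) := by
  have hα := quadratic_nonpos_of_le_two_sub_sqrt_two hα2
  have hβ := quadratic_nonpos_of_le_two_sub_sqrt_two hβ2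
  have hsum : μa * (-α ^ 2 + 4 * α - 2) + μb * (-β ^ 2 + 4 * β - 2) ≤ 0 :=
    add_nonpos (mul_nonpos_of_nonneg_of_nonpos hμa.le hα)
      (mul_nonpos_of_nonneg_of_nonpos hμb.le hβ)
  have hG : Gc μa μb α β 1 ≤ 0 := by
    rw [Gc_one]
    linarith
  exact ⟨hα, hβ, hsum, fun _ hs => Pfun_nonneg hG hs, fun _ hs => Ptfun_nonneg hG hs⟩
end
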